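/- Let n ≥ 2 and C > 0. There exists C' > 0, depending only on n and C, with the following property: if K is an origin-symmetric convex body in ℝⁿ with γ_n(K) > 1/2 whose Gaussian surface area measure has a density f with respect to the spherical Lebesgue measure on S^{n-1} (i.e., S_{γ_n,K}(η) = ∫_η f(v) dv for all Borel η ⊆ S^{n-1}) satisfying 1/C < f(v) < C for all v ∈ S^{n-1}, then 1/C' < h_K(v) < C' for all v ∈ S^{n-1}. -/

import Mathlib

open MeasureTheory Metric Set Filter
open scoped RealInnerProductSpace Topology Pointwise NNReal ENNReal

noncomputable section

/-- `ℝⁿ` as Euclidean space. -/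
abbrev Eu (n : ℕ) := EuclideanSpace ℝ (Fin n)

/-- The Gaussian measure `γₙ(A) = (2π)^{-n/2} ∫_A e^{-|x|²/2} dx`. -/
def gaussVol (n : ℕ) (A : Set (Eu n)) : ℝ :=
  (Real.sqrt (2 * Real.pi))⁻¹ ^ n * ∫ x in A, Real.exp (-‖x‖ ^ 2 / 2)

/-- A convex body: a compact convex set with nonempty interior. -/
def IsConvexBody {n : ℕ} (K : Set (Eu n)) : Prop :=
  Convex ℝ K ∧ IsCompact K ∧ (interior K).Nonempty

/-- The support function `h_K(v) = max_{y ∈ K} ⟪y, v⟫`. -/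
def suppFun {n : ℕ} (K : Set (Eu n)) (v : Eu n) : ℝ :=
  sSup ((fun y => ⟪y, v⟫) '' K)

/-- The Gaussian surface area measure of `K`, as a set function:
`S_{γₙ,K}(η) = (2π)^{-n/2} ∫_{ν_K⁻¹(η)} e^{-|x|²/2} dH^{n-1}(x)`, where
`ν_K⁻¹(η)` is the set of boundary points of `K` having an outer unit normal in `η`. -/
def gaussSurf (n : ℕ) (K : Set (Eu n)) (η : Set (Eu n)) : ℝ :=
  (Real.sqrt (2 * Real.pi))⁻¹ ^ n *
    ∫ x in {x | x ∈ frontier K ∧ ∃ v ∈ η, ⟪x, v⟫ = suppFun K v},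
      Real.exp (-‖x‖ ^ 2 / 2) ∂μH[(n : ℝ) - 1]

open Classical in
/-- (A choice of) Gauss map of `K`: to a boundary point `x` it assigns an outer unit
normal of `K` at `x` (for a convex body `K`, this is unique for `H^{n-1}`-a.e. `x ∈ ∂K`). -/
def gaussMap {n : ℕ} (K : Set (Eu n)) (x : Eu n) : Eu n :=
  if h : ∃ v : Eu n, ‖v‖ = 1 ∧ ⟪x, v⟫ = suppFun K v then h.choose else 0

/-- The Wulff shape `[g] = {x : x·v ≤ g v for all unit v}`. -/
def wulff {n : ℕ} (g : Eu n → ℝ) : Set (Eu n) :=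
  {x | ∀ v : Eu n, ‖v‖ = 1 → ⟪x, v⟫ ≤ g v}

/-- The radial function `ρ_K(u) = max {r : r • u ∈ K}`. -/
def radialFun {n : ℕ} (K : Set (Eu n)) (u : Eu n) : ℝ :=
  sSup {r : ℝ | r • u ∈ K}

/-- The standard Gaussian distribution function `Φ`. -/
def Phi (x : ℝ) : ℝ :=
  (Real.sqrt (2 * Real.pi))⁻¹ * ∫ t in Iic x, Real.exp (-t ^ 2 / 2)

/-- The inverse `Φ⁻¹` of the standard Gaussian distribution function. -/
def PhiInv : ℝ → ℝ := Function.invFun Phi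


lemma suppFun_le_of {n : ℕ} {K : Set (Eu n)} (hne : K.Nonempty) {v : Eu n} {a : ℝ}
    (h : ∀ y ∈ K, ⟪y, v⟫ ≤ a) : suppFun K v ≤ a := by
  apply csSup_le (hne.image _)
  rintro _ ⟨y, hy, rfl⟩
  exact h y hy

lemma le_suppFun {n : ℕ} {K : Set (Eu n)} (hK : IsCompact K) {v y : Eu n} (hy : y ∈ K) :
    ⟪y, v⟫ ≤ suppFun K v := by
  apply le_csSup
  · exact (hK.image (by fun_prop)).bddAbove
  · exact ⟨y, hy, rfl⟩

lemma exists_normal {n : ℕ} {K : Set (Eu n)} (hK : IsConvexBody K) {x : Eu n}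
    (hx : x ∈ frontier K) : ∃ v : Eu n, ‖v‖ = 1 ∧ ∀ z ∈ K, ⟪z, v⟫ ≤ ⟪x, v⟫ := by
  obtain ⟨hc, hcomp, hint⟩ := hK
  obtain ⟨g, hg⟩ := geometric_hahn_banach_open_point hc.interior isOpen_interior
    (fun h => (hx.2 h : False))
  set w := (InnerProductSpace.toDual ℝ (Eu n)).symm g with hw
  have hwg : ∀ z, ⟪z, w⟫ = g z := by
    intro z
    rw [real_inner_comm, hw, InnerProductSpace.toDual_symm_apply]
  have hw0 : w ≠ 0 := by
    intro h0
    obtain ⟨z, hz⟩ := hint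
    have := hg z hz
    rw [← hwg, ← hwg, h0] at this
    simp at this
  have hle : ∀ z ∈ K, ⟪z, w⟫ ≤ ⟪x, w⟫ := by
    intro z hz
    have hz' : z ∈ closure (interior K) := by
      rw [hc.closure_interior_eq_closure_of_nonempty_interior hint]
      exact subset_closure hz
    have hcl : IsClosed {z : Eu n | ⟪z, w⟫ ≤ ⟪x, w⟫} :=
      isClosed_le (by fun_prop) (by fun_prop)
    refine closure_minimal ?_ hcl hz'
    intro y hy
    show ⟪y, w⟫ ≤ ⟪x, w⟫
    rw [hwg, hwg]; exact (hg y hy).le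
  refine ⟨‖w‖⁻¹ • w, ?_, ?_⟩
  · rw [norm_smul, norm_inv, norm_norm, inv_mul_cancel₀ (norm_ne_zero_iff.2 hw0)]
  · intro z hz
    rw [inner_smul_right, inner_smul_right]
    exact mul_le_mul_of_nonneg_left (hle z hz) (by positivity)

/-- The boundary of the cube of half-side `R`. -/
def cubeBd (n : ℕ) (R : ℝ) : Set (Eu n) := {y | (∀ i, |y i| ≤ R) ∧ ∃ i, |y i| = R}

lemma abs_coord_le {n : ℕ} (x : Eu n) (i : Fin n) : |x i| ≤ ‖x‖ := by
  simpa using PiLp.norm_apply_le x i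

lemma exists_cubeBd {n : ℕ} {R : ℝ} (x v : Eu n) (hx : ‖x‖ ≤ R) (hv : ‖v‖ = 1) :
    ∃ t : ℝ, 0 ≤ t ∧ x + t • v ∈ cubeBd n R := by
  let g : ℝ → ℝ := fun t => ‖(WithLp.ofLp (x + t • v) : Fin n → ℝ)‖
  have hR : 0 ≤ R := (norm_nonneg _).trans hx
  have hg : Continuous g := by
    have : Continuous fun t : ℝ => (WithLp.ofLp (x + t • v) : Fin n → ℝ) := by fun_prop
    exact this.norm
  have h0 : g 0 ≤ R := by
    rw [pi_norm_le_iff_of_nonneg hR]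
    intro i
    simpa using (abs_coord_le x i).trans hx
  obtain ⟨i, hi⟩ : ∃ i, v i ≠ 0 := by
    by_contra! h
    have : v = 0 := by ext i; simpa using h i
    simp [this] at hv
  let T := (2 * R) / |v i|
  have hvi : 0 < |v i| := abs_pos.2 hi
  have hT : 0 ≤ T := by positivity
  have h1 : R ≤ g T := by
    have := norm_le_pi_norm (WithLp.ofLp (x + T • v) : Fin n → ℝ) i
    refine le_trans ?_ this
    have e : (x + T • v) i = x i + T * v i := by simp
    rw [e, Real.norm_eq_abs]
    have h2 : |T * v i| = 2 * R := by
      rw [abs_mul, abs_of_nonneg hT]; exact div_mul_cancel₀ _ hvi.ne'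
    have h3 := abs_sub_abs_le_abs_sub (T * v i) (-(x i))
    have h4 := (abs_coord_le x i).trans hx
    rw [abs_neg, h2] at h3
    have : T * v i - -(x i) = x i + T * v i := by ring
    rw [this] at h3; linarith
  obtain ⟨t, ht, hgt⟩ := intermediate_value_Icc hT hg.continuousOn ⟨h0, h1⟩
  refine ⟨t, ht.1, ?_, ?_⟩
  · intro j
    have := norm_le_pi_norm (WithLp.ofLp (x + t • v) : Fin n → ℝ) j
    rw [← hgt]; exact this
  · have : Nonempty (Fin n) := ⟨i⟩
    obtain ⟨j, hj⟩ := Finite.exists_max (fun j => |(x + t • v) j|)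
    refine ⟨j, le_antisymm ?_ ?_⟩
    · have := norm_le_pi_norm (WithLp.ofLp (x + t • v) : Fin n → ℝ) j
      rw [← hgt]; exact this
    · rw [← hgt]
      exact (pi_norm_le_iff_of_nonneg (abs_nonneg _)).2 hj

lemma frontier_le_cubeBd {n : ℕ} {K : Set (Eu n)} (hK : IsConvexBody K) {R : ℝ}
    (hR : ∀ x ∈ K, ‖x‖ ≤ R) {d : ℝ} (hd : 0 ≤ d) :
    μH[d] (frontier K) ≤ μH[d] (cubeBd n R) := by
  have hsub : frontier K ⊆ K := hK.2.1.isClosed.frontier_subset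
  have key : ∀ x : Eu n, ∃ v : Eu n, ∃ t : ℝ, x ∈ frontier K →
      (∀ z ∈ K, ⟪z, v⟫ ≤ ⟪x, v⟫) ∧ 0 ≤ t ∧ x + t • v ∈ cubeBd n R := by
    intro x
    by_cases hx : x ∈ frontier K
    · obtain ⟨v, hv, hv'⟩ := exists_normal hK hx
      obtain ⟨t, ht, h⟩ := exists_cubeBd x v (hR x (hsub hx)) hv
      exact ⟨v, t, fun _ => ⟨hv', ht, h⟩⟩
    · exact ⟨0, 0, fun h => absurd h hx⟩
  choose v t hvt using key
  let φ : Eu n → Eu n := fun x => x + t x • v x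
  have hφ : ∀ x ∈ frontier K, ∀ y ∈ frontier K, ‖x - y‖ ≤ ‖φ x - φ y‖ := by
    intro x hx y hy
    obtain ⟨h1, h2, _⟩ := hvt x hx
    obtain ⟨h3, h4, _⟩ := hvt y hy
    have a1 := mul_nonneg h2 (sub_nonneg.2 (h1 y (hsub hy)))
    have a2 := mul_nonneg h4 (sub_nonneg.2 (h3 x (hsub hx)))
    have e : ⟪φ x - φ y, x - y⟫ = ‖x - y‖ ^ 2 + t x * (⟪x, v x⟫ - ⟪y, v x⟫)
        + t y * (⟪y, v y⟫ - ⟪x, v y⟫) := by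
      rw [← real_inner_self_eq_norm_sq]
      simp only [φ, inner_sub_left, inner_sub_right, inner_add_left, inner_smul_left,
        real_inner_comm (v x), real_inner_comm (v y)]
      simp
      ring
    have b := real_inner_le_norm (φ x - φ y) (x - y)
    by_contra! hlt
    nlinarith [norm_nonneg (x - y), norm_nonneg (φ x - φ y)]
  have hinj : InjOn φ (frontier K) := by
    intro x hx y hy h
    have := hφ x hx y hy
    rw [h, sub_self, norm_zero] at this
    exact sub_eq_zero.1 (norm_le_zero_iff.1 this)
  rcases (frontier K).eq_empty_or_nonempty with he | ⟨x0, hx0⟩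
  · simp [he]
  have : Nonempty (Eu n) := ⟨x0⟩
  let ψ := Function.invFunOn φ (frontier K)
  have hψ : ∀ x ∈ frontier K, ψ (φ x) = x := fun x hx => hinj.leftInvOn_invFunOn hx
  have hlip : LipschitzOnWith 1 ψ (φ '' frontier K) := by
    apply LipschitzOnWith.of_dist_le_mul
    rintro _ ⟨x, hx, rfl⟩ _ ⟨y, hy, rfl⟩
    rw [hψ x hx, hψ y hy, dist_eq_norm, dist_eq_norm]
    simpa using hφ x hx y hy
  have hss : frontier K ⊆ ψ '' (φ '' frontier K) := by
    intro x hx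
    exact ⟨φ x, ⟨x, hx, rfl⟩, hψ x hx⟩
  calc μH[d] (frontier K) ≤ μH[d] (ψ '' (φ '' frontier K)) := measure_mono hss
    _ ≤ ((1 : ℝ≥0) : ℝ≥0∞) ^ d * μH[d] (φ '' frontier K) := hlip.hausdorffMeasure_image_le hd
    _ = μH[d] (φ '' frontier K) := by simp
    _ ≤ _ := by
      apply measure_mono
      rintro _ ⟨x, hx, rfl⟩
      exact (hvt x hx).2.2

/-- Insert a coordinate. -/
def insMap {m : ℕ} (i : Fin (m + 1)) (a : ℝ) (w : Fin m → ℝ) : Eu (m + 1) :=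
  WithLp.toLp 2 (i.insertNth a w : Fin (m + 1) → ℝ)

lemma exists_insMap_lip (m : ℕ) : ∃ L : ℝ≥0, ∀ (i : Fin (m + 1)) (a : ℝ),
    LipschitzWith L (insMap i a : (Fin m → ℝ) → Eu (m + 1)) := by
  refine ⟨_, fun i a => (PiLp.lipschitzWith_toLp 2 (fun _ : Fin (m + 1) => ℝ)).comp
    (g := fun w : Fin m → ℝ => (i.insertNth a w : Fin (m + 1) → ℝ)) (Kg := 1) ?_⟩
  apply LipschitzWith.of_dist_le_mul
  intro x y
  simp only [NNReal.coe_one, one_mul]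
  rw [dist_pi_le_iff dist_nonneg]
  intro j
  refine Fin.succAboveCases i ?_ ?_ j
  · simp
  · intro k
    simpa using dist_le_pi_dist x y k

lemma cubeBd_bound (m : ℕ) : ∃ M : ℝ, 0 ≤ M ∧ ∀ R : ℝ, 0 ≤ R →
    μH[(m : ℝ)] (cubeBd (m + 1) R) ≤ ENNReal.ofReal (M * R ^ m) := by
  obtain ⟨L, hL⟩ := exists_insMap_lip m
  refine ⟨(m + 1) * (2 * (L * 2) ^ m), by positivity, fun R hR => ?_⟩
  have hface : ∀ (i : Fin (m + 1)) (a : ℝ),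
      μH[(m : ℝ)] (insMap i a '' Icc (fun _ => -R) (fun _ => R))
        ≤ ENNReal.ofReal ((L * 2) ^ m * R ^ m) := by
    intro i a
    refine ((hL i a).hausdorffMeasure_image_le (Nat.cast_nonneg m) _).trans ?_
    have : (μH[(m : ℝ)] : Measure (Fin m → ℝ)) = volume := by
      have := hausdorffMeasure_pi_real (ι := Fin m)
      simpa using this
    rw [this, Real.volume_Icc_pi]
    simp only [Finset.prod_const, Finset.card_univ, Fintype.card_fin]
    rw [ENNReal.rpow_natCast, ← mul_pow, ← mul_pow, ENNReal.ofReal_pow (by positivity)]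
    gcongr
    rw [mul_assoc, ENNReal.ofReal_mul (by positivity)]
    simp only [ENNReal.ofReal_coe_nnreal]
    gcongr
    linarith
  have hsub : cubeBd (m + 1) R ⊆ ⋃ i : Fin (m + 1),
      ((insMap i R '' Icc (fun _ => -R) (fun _ => R)) ∪
        (insMap i (-R) '' Icc (fun _ => -R) (fun _ => R))) := by
    rintro y ⟨h1, i, hi⟩
    have hmem : (fun j => y (i.succAbove j)) ∈ Icc (fun _ : Fin m => -R) (fun _ => R) :=
      ⟨fun j => (abs_le.1 (h1 _)).1, fun j => (abs_le.1 (h1 _)).2⟩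
    have hins : insMap i (y i) (fun j => y (i.succAbove j)) = y := by
      ext j
      refine Fin.succAboveCases i ?_ ?_ j <;> simp [insMap]
    refine mem_iUnion.2 ⟨i, ?_⟩
    rcases (abs_eq hR).1 hi with h | h
    · left; exact ⟨_, hmem, by rw [← h]; exact hins⟩
    · right; exact ⟨_, hmem, by rw [← h]; exact hins⟩
  calc μH[(m : ℝ)] (cubeBd (m + 1) R) ≤ _ := measure_mono hsub
    _ ≤ ∑ i : Fin (m + 1), _ := measure_iUnion_fintype_le _ _
    _ ≤ ∑ i : Fin (m + 1), (ENNReal.ofReal ((L * 2) ^ m * R ^ m)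
          + ENNReal.ofReal ((L * 2) ^ m * R ^ m)) := by
        refine Finset.sum_le_sum fun i _ => ?_
        exact (measure_union_le _ _).trans (add_le_add (hface i R) (hface i (-R)))
    _ = _ := by
        rw [← ENNReal.ofReal_add (by positivity) (by positivity)]
        simp only [Finset.sum_const, Finset.card_univ, Fintype.card_fin, nsmul_eq_mul]
        rw [← ENNReal.ofReal_natCast, ← ENNReal.ofReal_mul (by positivity)]
        congr 1
        push_cast; ring

/-- Forget the zeroth coordinate. -/
def tailMap {m : ℕ} (y : Eu (m + 1)) : Fin m → ℝ := fun j => y j.succ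

lemma tailMap_image_le {m : ℕ} (s : Set (Eu (m + 1))) :
    volume (tailMap '' s) ≤ μH[(m : ℝ)] s := by
  have hl : LipschitzWith 1 (tailMap : Eu (m + 1) → Fin m → ℝ) := by
    apply LipschitzWith.of_dist_le_mul
    intro x y
    simp only [NNReal.coe_one, one_mul]
    rw [dist_pi_le_iff dist_nonneg]
    intro j
    rw [dist_eq_norm, dist_eq_norm, Real.norm_eq_abs]
    simpa [tailMap] using abs_coord_le (x - y) j.succ
  have : (μH[(m : ℝ)] : Measure (Fin m → ℝ)) = volume := by
    have := hausdorffMeasure_pi_real (ι := Fin m)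
    simpa using this
  rw [← this]
  simpa using hl.hausdorffMeasure_image_le (Nat.cast_nonneg m) s

/-- the zeroth basis vector -/
def ez (m : ℕ) : Eu (m + 1) := EuclideanSpace.single 0 1

lemma norm_ez (m : ℕ) : ‖ez m‖ = 1 := by simp [ez]

lemma inner_ez {m : ℕ} (x : Eu (m + 1)) : ⟪x, ez m⟫ = x 0 := by
  simp [ez, EuclideanSpace.inner_single_right]

lemma exists_rot {n : ℕ} (v w : Eu n) (h : ‖v‖ = ‖w‖) : ∃ e : Eu n ≃ₗᵢ[ℝ] Eu n, e v = w :=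
  ⟨_, Submodule.reflection_sub h⟩

lemma cap_pos (m : ℕ) :
    0 < μH[(m : ℝ)] {v : Eu (m + 1) | ‖v‖ = 1 ∧ 1 / 2 ≤ ⟪v, ez m⟫} := by
  have ho : IsOpen {w : Fin m → ℝ | ∑ j, w j ^ 2 < 3 / 4} :=
    isOpen_lt (by fun_prop) continuous_const
  have hp := ho.measure_pos volume ⟨0, by simp⟩
  refine hp.trans_le ((measure_mono ?_).trans (tailMap_image_le _))
  intro w hw
  have hw : ∑ j, w j ^ 2 < 3 / 4 := hw
  refine ⟨insMap 0 (Real.sqrt (1 - ∑ j, w j ^ 2)) w, ⟨?_, ?_⟩, ?_⟩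
  · rw [EuclideanSpace.norm_eq, Real.sqrt_eq_one, Fin.sum_univ_succ]
    simp [insMap]
    rw [Real.sq_sqrt (by linarith)]; ring
  · rw [inner_ez]
    simp only [insMap, Fin.insertNth_zero]
    show 1 / 2 ≤ Real.sqrt (1 - ∑ j, w j ^ 2)
    apply Real.le_sqrt_of_sq_le
    linarith
  · ext j; simp [tailMap, insMap]

lemma cap_eq (m : ℕ) (v0 : Eu (m + 1)) (h : ‖v0‖ = 1) :
    μH[(m : ℝ)] {v : Eu (m + 1) | ‖v‖ = 1 ∧ 1 / 2 ≤ ⟪v, v0⟫} =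
    μH[(m : ℝ)] {v : Eu (m + 1) | ‖v‖ = 1 ∧ 1 / 2 ≤ ⟪v, ez m⟫} := by
  obtain ⟨e, he⟩ := exists_rot (ez m) v0 (by rw [h, norm_ez])
  rw [← e.isometry.hausdorffMeasure_image (Or.inr e.surjective)
    {v : Eu (m + 1) | ‖v‖ = 1 ∧ 1 / 2 ≤ ⟪v, ez m⟫}]
  congr 1
  ext v
  obtain ⟨u, rfl⟩ := e.surjective v
  simp only [mem_ofPred_eq, mem_image]
  constructor
  · rintro ⟨h1, h2⟩
    refine ⟨u, ⟨by simpa using h1, ?_⟩, rfl⟩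
    rwa [← he, e.inner_map_map] at h2
  · rintro ⟨u', ⟨h1, h2⟩, h3⟩
    rw [← h3, ← he, e.inner_map_map]
    exact ⟨by simpa using h1, h2⟩

lemma frontier_pos {m : ℕ} {K : Set (Eu (m + 1))} (hK : IsConvexBody K) :
    0 < μH[(m : ℝ)] (frontier K) := by
  obtain ⟨z, hz⟩ := hK.2.2
  have hcont : Continuous fun w : Fin m → ℝ => insMap 0 (z 0) w :=
    (exists_insMap_lip m).choose_spec 0 (z 0) |>.continuous
  have ho : IsOpen ((fun w : Fin m → ℝ => insMap 0 (z 0) w) ⁻¹' interior K) :=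
    isOpen_interior.preimage hcont
  have hp := ho.measure_pos volume ⟨tailMap z, by
    have : insMap 0 (z 0) (tailMap z) = z := by
      ext j
      refine Fin.cases ?_ ?_ j <;> simp [insMap, tailMap]
    rwa [mem_preimage, this]⟩
  refine hp.trans_le ((measure_mono ?_).trans (tailMap_image_le _))
  intro w hw
  have hw : insMap 0 (z 0) w ∈ interior K := hw
  let t : Set (Eu (m + 1)) := range fun a : ℝ => insMap 0 (z 0) w + a • ez m
  have ht : IsPreconnected t := isPreconnected_range (by fun_prop)
  obtain ⟨B, hB⟩ := hK.2.1.isBounded.exists_norm_le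
  have h2 : (t ∩ Kᶜ).Nonempty := by
    refine ⟨_, ⟨B - z 0 + 1, rfl⟩, fun hmem => ?_⟩
    have h3 := (abs_coord_le _ 0).trans (hB _ hmem)
    have e : (insMap 0 (z 0) w + (B - z 0 + 1) • ez m) 0 = B + 1 := by
      simp [insMap, ez]; ring
    rw [e] at h3
    linarith [le_abs_self (B + 1)]
  obtain ⟨y, ⟨a, rfl⟩, hy⟩ : (t ∩ frontier K).Nonempty := by
    by_contra hem
    have hcov : t ⊆ interior K ∪ Kᶜ := by
      intro y hy
      by_cases h1 : y ∈ interior K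
      · exact Or.inl h1
      · right
        intro hyK
        exact hem ⟨y, hy, subset_closure hyK, h1⟩
    obtain ⟨y, _, h1, h3⟩ := ht _ _ isOpen_interior hK.2.1.isClosed.isOpen_compl hcov
      ⟨_, ⟨0, by simp⟩, hw⟩ h2
    exact h3 (interior_subset h1)
  refine ⟨_, hy, ?_⟩
  ext j
  simp [tailMap, insMap, ez]

lemma integrable_gauss (n : ℕ) : Integrable (fun x : Eu n => Real.exp (-‖x‖ ^ 2 / 2)) := by
  have h := (GaussianFourier.integrable_cexp_neg_mul_sq_norm_add (V := Eu n) (b := 1 / 2)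
    (by norm_num) 0 0).re
  refine h.congr (Eventually.of_forall fun x => ?_)
  simp only [zero_mul, add_zero]
  have : (-(1 / 2) * (‖x‖ : ℂ) ^ 2 : ℂ) = ((-‖x‖ ^ 2 / 2 : ℝ) : ℂ) := by
    push_cast; ring
  rw [this, ← Complex.ofReal_exp]
  exact Complex.ofReal_re _

/-- symmetric slab -/
def slab {n : ℕ} (v : Eu n) (h : ℝ) : Set (Eu n) := {x | |⟪x, v⟫| ≤ h}

lemma isClosed_slab {n : ℕ} (v : Eu n) (h : ℝ) : IsClosed (slab v h) :=
  isClosed_le (by fun_prop) continuous_const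

lemma slab_rot {m : ℕ} (v : Eu (m + 1)) (hv : ‖v‖ = 1) (h : ℝ) :
    gaussVol (m + 1) (slab v h) = gaussVol (m + 1) (slab (ez m) h) := by
  obtain ⟨e, he⟩ := exists_rot (ez m) v (by rw [hv, norm_ez])
  unfold gaussVol
  congr 1
  have := e.measurePreserving.setIntegral_preimage_emb
    e.toHomeomorph.measurableEmbedding (fun x => Real.exp (-‖x‖ ^ 2 / 2)) (slab v h)
  rw [← this]
  have h2 : e ⁻¹' slab v h = slab (ez m) h := by
    ext x
    simp only [slab, mem_preimage, mem_ofPred_eq, ← he, e.inner_map_map]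
  rw [h2]
  simp

lemma exists_slab (m : ℕ) : ∃ h > 0, gaussVol (m + 1) (slab (ez m) h) < 1 / 2 := by
  have hanti : Antitone fun k : ℕ => slab (ez m) (1 / ((k : ℝ) + 1)) := by
    intro a b hab x hx
    have hx : |⟪x, ez m⟫| ≤ 1 / ((b : ℝ) + 1) := hx
    refine le_trans hx ?_
    exact Nat.one_div_le_one_div hab
  have ht := tendsto_setIntegral_of_antitone (μ := volume)
    (fun k : ℕ => (isClosed_slab (ez m) (1 / ((k : ℝ) + 1))).measurableSet) hanti
    ⟨0, (integrable_gauss (m + 1)).integrableOn⟩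
  have hz : volume (⋂ k : ℕ, slab (ez m) (1 / ((k : ℝ) + 1))) = 0 := by
    let S : Submodule ℝ (Eu (m + 1)) := (ℝ ∙ ez m)ᗮ
    have hS : S ≠ ⊤ := by
      intro h
      have : ez m ∈ S := by rw [h]; trivial
      have := Submodule.mem_orthogonal_singleton_iff_inner_right.1 this
      rw [real_inner_self_eq_norm_sq, norm_ez] at this
      norm_num at this
    refine measure_mono_null ?_ (Measure.addHaar_submodule volume S hS)
    intro x hx
    have hx : ∀ k : ℕ, |⟪x, ez m⟫| ≤ 1 / ((k : ℝ) + 1) := fun k => mem_iInter.1 hx k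
    have h0 : |⟪x, ez m⟫| ≤ 0 :=
      ge_of_tendsto' tendsto_one_div_add_atTop_nhds_zero_nat hx
    refine Submodule.mem_orthogonal_singleton_iff_inner_left.2 ?_
    exact abs_nonpos_iff.1 h0
  rw [setIntegral_measure_zero _ hz] at ht
  have ht2 := ht.const_mul ((Real.sqrt (2 * Real.pi))⁻¹ ^ (m + 1))
  rw [mul_zero] at ht2
  obtain ⟨k, hk⟩ := (ht2.eventually_lt_const (show (0 : ℝ) < 1 / 2 by norm_num)).exists
  exact ⟨_, by positivity, hk⟩

lemma lower_bound (m : ℕ) : ∃ r > 0, ∀ K : Set (Eu (m + 1)), IsConvexBody K → K = -K →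
    1 / 2 < gaussVol (m + 1) K → ∀ v : Eu (m + 1), ‖v‖ = 1 → r < suppFun K v := by
  obtain ⟨r, hr, hs⟩ := exists_slab m
  refine ⟨r, hr, fun K hK hsymm hvol v hv => ?_⟩
  by_contra! hle
  have hsub : K ⊆ slab v r := by
    intro x hx
    have h1 := le_suppFun hK.2.1 (v := v) hx
    have hx' : -x ∈ K := by rw [hsymm]; simpa using hx
    have h2 := le_suppFun hK.2.1 (v := v) hx'
    rw [inner_neg_left] at h2
    show |⟪x, v⟫| ≤ r
    exact abs_le.2 ⟨by linarith, by linarith⟩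
  have : gaussVol (m + 1) K ≤ gaussVol (m + 1) (slab v r) := by
    unfold gaussVol
    gcongr
    · exact Eventually.of_forall fun x => (Real.exp_pos _).le
    · exact (integrable_gauss _).integrableOn
  rw [slab_rot v hv] at this
  linarith

lemma upper_bound (m : ℕ) (C : ℝ) (hC : 0 < C) : ∃ R0 > 0, ∀ K : Set (Eu (m + 1)),
    ∀ f : Eu (m + 1) → ℝ, IsConvexBody K →
    (∀ η ⊆ sphere (0 : Eu (m + 1)) 1, MeasurableSet η →
        gaussSurf (m + 1) K η = ∫ v in η, f v ∂μH[(m : ℝ)]) →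
    (∀ v : Eu (m + 1), ‖v‖ = 1 → 1 / C < f v) →
    ∀ v : Eu (m + 1), ‖v‖ = 1 → suppFun K v < R0 := by
  obtain ⟨M, hM, hMb⟩ := cubeBd_bound m
  obtain ⟨c, hc0, hc⟩ : ∃ c : ℝ, 0 < c ∧ ENNReal.ofReal c ≤
      μH[(m : ℝ)] {v : Eu (m + 1) | ‖v‖ = 1 ∧ 1 / 2 ≤ ⟪v, ez m⟫} := by
    obtain ⟨c, h1, h2⟩ := ENNReal.lt_iff_exists_nnreal_btwn.1 (cap_pos m)
    refine ⟨c, by exact_mod_cast h1, ?_⟩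
    rw [ENNReal.ofReal_coe_nnreal]; exact h2.le
  let a : ℝ := (Real.sqrt (2 * Real.pi))⁻¹ ^ (m + 1)
  have ha : 0 < a := by positivity
  have ht := (Real.tendsto_pow_mul_exp_neg_atTop_nhds_zero m).const_mul (a * M)
  rw [mul_zero] at ht
  have hcC : 0 < 1 / C * c := by positivity
  obtain ⟨R1, hR1⟩ := eventually_atTop.1 (ht.eventually_lt_const hcC)
  refine ⟨max R1 8, by positivity, fun K f hK hf hfC v hv => ?_⟩
  have hne : K.Nonempty := hK.2.2.mono interior_subset
  obtain ⟨x0, hx0, hmax⟩ := hK.2.1.exists_isMaxOn hne continuous_norm.continuousOn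
  set R := ‖x0‖ with hR
  have hmax : ∀ x ∈ K, ‖x‖ ≤ R := fun x hx => hmax hx
  suffices hlt : R < max R1 8 by
    refine lt_of_le_of_lt (suppFun_le_of hne fun y hy => ?_) hlt
    calc ⟪y, v⟫ ≤ ‖y‖ * ‖v‖ := real_inner_le_norm _ _
      _ ≤ R := by rw [hv, mul_one]; exact hmax y hy
  by_contra! hge
  have hge1 : R1 ≤ R := (le_max_left _ _).trans hge
  have hge8 : 8 ≤ R := (le_max_right _ _).trans hge
  have hRpos : 0 < R := by linarith
  have hfr : μH[(m : ℝ)] (frontier K) ≤ ENNReal.ofReal (M * R ^ m) :=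
    (frontier_le_cubeBd hK hmax (Nat.cast_nonneg m)).trans (hMb R hRpos.le)
  have hfrtop : μH[(m : ℝ)] (frontier K) < ∞ := hfr.trans_lt ENNReal.ofReal_lt_top
  have hcast : (((m + 1 : ℕ) : ℝ) - 1) = (m : ℝ) := by push_cast; ring
  -- total mass is nonzero
  have htot : gaussSurf (m + 1) K (sphere 0 1) ≠ 0 := by
    unfold gaussSurf
    rw [hcast]
    have hset : {x | x ∈ frontier K ∧ ∃ v ∈ sphere (0 : Eu (m + 1)) 1,
        ⟪x, v⟫ = suppFun K v} = frontier K := by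
      ext x
      refine ⟨fun h => h.1, fun h => ⟨h, ?_⟩⟩
      obtain ⟨u, hu, hu'⟩ := exists_normal hK h
      refine ⟨u, by simpa using hu, le_antisymm ?_ (suppFun_le_of hne hu')⟩
      exact le_suppFun hK.2.1 (hK.2.1.isClosed.frontier_subset h)
    rw [hset]
    refine (mul_pos ha ?_).ne'
    have hfin : IsFiniteMeasure ((μH[(m : ℝ)] : Measure (Eu (m + 1))).restrict (frontier K)) :=
      ⟨by simpa using hfrtop⟩
    have hint : Integrable (fun x : Eu (m + 1) => Real.exp (-‖x‖ ^ 2 / 2))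
        ((μH[(m : ℝ)] : Measure (Eu (m + 1))).restrict (frontier K)) := by
      refine Integrable.of_bound (by fun_prop) 1 (Eventually.of_forall fun x => ?_)
      rw [Real.norm_eq_abs, abs_of_pos (Real.exp_pos _), Real.exp_le_one_iff]
      nlinarith [sq_nonneg ‖x‖]
    rw [integral_pos_iff_support_of_nonneg (fun x => (Real.exp_pos _).le) hint]
    have : Function.support (fun x : Eu (m + 1) => Real.exp (-‖x‖ ^ 2 / 2)) = univ := by
      ext x; simp [(Real.exp_pos _).ne']
    rw [this, Measure.restrict_apply_univ]
    exact frontier_pos hK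
  have hfint : IntegrableOn f (sphere 0 1) (μH[(m : ℝ)]) := by
    by_contra hni
    apply htot
    rw [hf _ subset_rfl isClosed_sphere.measurableSet]
    exact integral_undef hni
  let v0 : Eu (m + 1) := R⁻¹ • x0
  have hv0 : ‖v0‖ = 1 := by
    rw [norm_smul, norm_inv, Real.norm_of_nonneg hRpos.le, ← hR, inv_mul_cancel₀ hRpos.ne']
  let η : Set (Eu (m + 1)) := {v | ‖v‖ = 1 ∧ 1 / 2 ≤ ⟪v, v0⟫}
  have hηs : η ⊆ sphere (0 : Eu (m + 1)) 1 := fun v hv => by simpa using hv.1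
  have hηm : MeasurableSet η := by
    have h1 : IsClosed {v : Eu (m + 1) | ‖v‖ = 1} :=
      isClosed_eq continuous_norm continuous_const
    have h2 : IsClosed {v : Eu (m + 1) | 1 / 2 ≤ ⟪v, v0⟫} :=
      isClosed_le continuous_const (by fun_prop)
    exact (h1.inter h2).measurableSet
  have hfη : IntegrableOn f η (μH[(m : ℝ)]) := hfint.mono_set hηs
  have hηc : ENNReal.ofReal c ≤ μH[(m : ℝ)] η := hc.trans_eq (cap_eq m v0 hv0).symm
  have hηtop : μH[(m : ℝ)] η < ∞ := by
    have h1 := hfη.measure_norm_ge_lt_top (show 0 < 1 / C by positivity)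
    rw [Measure.restrict_apply' hηm] at h1
    refine lt_of_le_of_lt (measure_mono ?_) h1
    intro v hv
    exact ⟨(hfC v hv.1).le.trans (le_abs_self _), hv⟩
  have hlow : 1 / C * c ≤ ∫ v in η, f v ∂μH[(m : ℝ)] := by
    have h1 : ∫ v in η, (1 / C) ∂μH[(m : ℝ)] ≤ ∫ v in η, f v ∂μH[(m : ℝ)] :=
      setIntegral_mono_on (integrableOn_const hηtop.ne) hfη hηm fun v hv => (hfC v hv.1).le
    rw [setIntegral_const, smul_eq_mul, mul_comm] at h1
    refine le_trans ?_ h1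
    gcongr
    exact (ENNReal.ofReal_le_iff_le_toReal hηtop.ne).1 hηc
  rw [← hf η hηs hηm] at hlow
  have hup : gaussSurf (m + 1) K η ≤ a * (Real.exp (-R) * (M * R ^ m)) := by
    unfold gaussSurf
    rw [hcast]
    refine mul_le_mul_of_nonneg_left ?_ ha.le
    have hAsub : {x | x ∈ frontier K ∧ ∃ v ∈ η, ⟪x, v⟫ = suppFun K v} ⊆ frontier K :=
      fun x hx => hx.1
    have hA := (measure_mono (μ := μH[(m : ℝ)]) hAsub).trans hfr
    refine (Real.le_norm_self _).trans ((norm_setIntegral_le_of_norm_le_const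
      (hA.trans_lt ENNReal.ofReal_lt_top) (C := Real.exp (-R)) ?_).trans ?_)
    · rintro x ⟨_, u, ⟨hu1, hu2⟩, hxu⟩
      rw [Real.norm_eq_abs, abs_of_pos (Real.exp_pos _), Real.exp_le_exp]
      have h1 : R / 2 ≤ suppFun K u := by
        refine le_trans ?_ (le_suppFun hK.2.1 hx0)
        have : x0 = R • v0 := by
          simp only [v0]; rw [smul_smul, mul_inv_cancel₀ hRpos.ne', one_smul]
        rw [this, real_inner_smul_left, real_inner_comm]
        nlinarith
      have h2 : ⟪x, u⟫ ≤ ‖x‖ * ‖u‖ := real_inner_le_norm _ _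
      rw [hu1, mul_one] at h2
      have h3 : R / 2 ≤ ‖x‖ := by linarith
      nlinarith
    · gcongr
      exact ENNReal.toReal_le_of_le_ofReal (by positivity) hA
  have := hR1 R hge1
  have e : a * M * (R ^ m * Real.exp (-R)) = a * (Real.exp (-R) * (M * R ^ m)) := by ring
  rw [e] at this
  linarith

/-- `C⁰` estimate: if the Gaussian surface area measure of an origin-symmetric convex
body `K` with `γₙ(K) > 1/2` has a density `f` with `1/C < f < C` on the sphere, then
`1/C' < h_K < C'` for a constant `C'` depending only on `n` and `C`. -/
theorem c0_estimate
    (n : ℕ) (hn : 2 ≤ n) (C : ℝ) (hC : 0 < C) :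
    ∃ C' > 0, ∀ K : Set (Eu n), ∀ f : Eu n → ℝ,
      IsConvexBody K → K = -K → 1 / 2 < gaussVol n K →
      (∀ η ⊆ sphere (0 : Eu n) 1, MeasurableSet η →
        gaussSurf n K η = ∫ v in η, f v ∂μH[(n : ℝ) - 1]) →
      (∀ v : Eu n, ‖v‖ = 1 → 1 / C < f v ∧ f v < C) →
      ∀ v : Eu n, ‖v‖ = 1 → 1 / C' < suppFun K v ∧ suppFun K v < C' := by
  obtain ⟨m, rfl⟩ : ∃ m, n = m + 1 := ⟨n - 1, by omega⟩
  have hcast : (((m + 1 : ℕ) : ℝ) - 1) = (m : ℝ) := by push_cast; ring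
  obtain ⟨r, hr, hlow⟩ := lower_bound m
  obtain ⟨R0, hR0, hup⟩ := upper_bound m C hC
  refine ⟨max R0 (1 / r), by positivity, fun K f hK hsymm hvol hf hfC v hv => ⟨?_, ?_⟩⟩
  · refine lt_of_le_of_lt ?_ (hlow K hK hsymm hvol v hv)
    rw [one_div_le (by positivity) hr]
    exact le_max_right _ _
  · rw [hcast] at hf
    exact (hup K f hK hf (fun v hv => (hfC v hv).1) v hv).trans_le (le_max_left _ _)
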